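/- Let G be a Γ-group and let τ: P → G and τ₁: P₁ → G be two projective presentations of G, with R = ker τ and R₁ = ker τ₁. Then there is an isomorphism of abelian groups (R ∩ [P,P]_Γ)/[P,R]_Γ ≅ (R₁ ∩ [P₁,P₁]_Γ)/[P₁,R₁]_Γ; that is, the group (R ∩ [P,P]_Γ)/[P,R]_Γ does not depend on the choice of projective presentation of G. -/

import Mathlib

/-- The Γ-commutator subgroup `[G,G]_Γ` of a Γ-group `G`: the subgroup generated by all
commutators together with the elements `(σ • g) * g⁻¹`. -/
def gammaCommutator (Γ G : Type*) [Group Γ] [Group G] [MulDistribMulAction Γ G] : Subgroup G :=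
  Subgroup.closure ({x | ∃ a b : G, x = a * b * a⁻¹ * b⁻¹} ∪
    {x | ∃ (σ : Γ) (g : G), x = σ • g * g⁻¹})

instance gammaCommutator_normal (Γ G : Type*) [Group Γ] [Group G] [MulDistribMulAction Γ G] :
    (gammaCommutator Γ G).Normal := by
  constructor
  intro n hn g
  have h1 : g * n * g⁻¹ * n⁻¹ ∈ gammaCommutator Γ G :=
    Subgroup.subset_closure (Or.inl ⟨g, n, rfl⟩)
  have h2 := mul_mem h1 hn
  simpa [mul_assoc] using h2

theorem gammaCommutator_smul_mem {Γ G : Type*} [Group Γ] [Group G] [MulDistribMulAction Γ G]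
    (σ : Γ) {x : G} (hx : x ∈ gammaCommutator Γ G) : σ • x ∈ gammaCommutator Γ G := by
  induction hx using Subgroup.closure_induction with
  | mem y hy =>
    rcases hy with ⟨a, b, rfl⟩ | ⟨τ, g, rfl⟩
    · refine Subgroup.subset_closure (Or.inl ⟨σ • a, σ • b, ?_⟩)
      simp [smul_mul', smul_inv']
    · refine Subgroup.subset_closure (Or.inr ⟨σ * τ * σ⁻¹, σ • g, ?_⟩)
      rw [smul_mul', smul_inv', ← mul_smul, ← mul_smul]
      simp [mul_assoc]
  | one => simpa using one_mem (gammaCommutator Γ G)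
  | mul a b _ _ iha ihb => rw [smul_mul']; exact mul_mem iha ihb
  | inv a _ iha => rw [smul_inv']; exact inv_mem iha

instance gammaCommutatorAction (Γ G : Type*) [Group Γ] [Group G] [MulDistribMulAction Γ G] :
    MulDistribMulAction Γ (gammaCommutator Γ G) where
  smul σ x := ⟨σ • (x : G), gammaCommutator_smul_mem σ x.2⟩
  one_smul x := Subtype.ext (one_smul Γ (x : G))
  mul_smul σ τ x := Subtype.ext (mul_smul σ τ (x : G))
  smul_mul σ x y := Subtype.ext (smul_mul' σ (x : G) (y : G))
  smul_one σ := Subtype.ext (smul_one σ)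

instance gammaAbelianization_commGroup (Γ G : Type*) [Group Γ] [Group G]
    [MulDistribMulAction Γ G] : CommGroup (G ⧸ gammaCommutator Γ G) where
  mul_comm a b := by
    induction a using QuotientGroup.induction_on with
    | _ x =>
    induction b using QuotientGroup.induction_on with
    | _ y =>
    rw [← QuotientGroup.mk_mul, ← QuotientGroup.mk_mul, QuotientGroup.eq]
    exact Subgroup.subset_closure (Or.inl ⟨y⁻¹, x⁻¹, by group⟩)

universe u v

/-- `φ : B →* G` is a central Γ-equivariant extension of the Γ-group `G`. -/
def IsCentralGammaExt (Γ : Type u) [Group Γ] {B G : Type v} [Group B] [Group G]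
    [MulDistribMulAction Γ B] [MulDistribMulAction Γ G] (φ : B →* G) : Prop :=
  (∀ (σ : Γ) (b : B), φ (σ • b) = σ • φ b) ∧ Function.Surjective φ ∧
    φ.ker ≤ Subgroup.center B ∧ (∀ (σ : Γ), ∀ b ∈ φ.ker, σ • b = b) ∧
    ∃ γ : G → B, (∀ (σ : Γ) (g : G), γ (σ • g) = σ • γ g) ∧ ∀ g, φ (γ g) = g

/-- A central Γ-equivariant extension `β : U →* G` is universal if for every central
Γ-equivariant extension `α : X →* G` there is a unique Γ-homomorphism `U →* X` over `G`. -/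
def IsUniversalCentralGammaExt (Γ : Type u) [Group Γ] {U G : Type v} [Group U] [Group G]
    [MulDistribMulAction Γ U] [MulDistribMulAction Γ G] (β : U →* G) : Prop :=
  IsCentralGammaExt Γ β ∧
    ∀ (X : Type v) [Group X] [MulDistribMulAction Γ X] (α : X →* G),
      IsCentralGammaExt Γ α →
        ∃! f : U →* X, (∀ (σ : Γ) (u : U), f (σ • u) = σ • f u) ∧ α.comp f = β

/-- The action of `Γ` on the free group on a Γ-set `X`, determined on generators by
`σ • ⟨x⟩ = ⟨σ • x⟩`. -/
instance freeGroupGammaAction (Γ X : Type*) [Group Γ] [MulAction Γ X] :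
    MulDistribMulAction Γ (FreeGroup X) where
  smul σ w := FreeGroup.map (σ • ·) w
  one_smul w := by
    show FreeGroup.map _ w = w
    rw [show ((fun x : X => (1 : Γ) • x)) = id from funext fun x => one_smul Γ x]
    exact FreeGroup.map.id w
  mul_smul σ τ w := by
    show FreeGroup.map _ w = FreeGroup.map _ (FreeGroup.map _ w)
    rw [FreeGroup.map.comp]
    have h : ((fun x : X => σ • x) ∘ fun x : X => τ • x) = fun x : X => (σ * τ) • x :=
      funext fun x => (mul_smul σ τ x).symm
    rw [h]
  smul_mul σ x y := map_mul (FreeGroup.map (σ • ·)) x y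
  smul_one σ := map_one (FreeGroup.map (σ • ·))

/-- For a normal Γ-invariant subgroup `H` of a Γ-group `G`, the subgroup `[G,H]_Γ`
generated by the elements `x * (σ • y) * x⁻¹ * y⁻¹` with `x ∈ G`, `y ∈ H`, `σ ∈ Γ`. -/
def gammaRelComm (Γ : Type*) {G : Type*} [Group Γ] [Group G] [MulDistribMulAction Γ G]
    (H : Subgroup G) : Subgroup G :=
  Subgroup.closure {x | ∃ (a : G) (σ : Γ), ∃ y ∈ H, x = a * (σ • y) * a⁻¹ * y⁻¹}

theorem gammaRelComm_le (Γ : Type*) {G : Type*} [Group Γ] [Group G] [MulDistribMulAction Γ G]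
    (H : Subgroup G) [hn : H.Normal] (hinv : ∀ (σ : Γ), ∀ y ∈ H, σ • y ∈ H) :
    gammaRelComm Γ H ≤ H := by
  rw [gammaRelComm, Subgroup.closure_le]
  rintro x ⟨a, σ, y, hy, rfl⟩
  exact mul_mem (hn.conj_mem _ (hinv σ y hy) a) (inv_mem hy)

theorem gammaRelComm_normal (Γ : Type*) {G : Type*} [Group Γ] [Group G]
    [MulDistribMulAction Γ G] (H : Subgroup G) [hn : H.Normal]
    (hinv : ∀ (σ : Γ), ∀ y ∈ H, σ • y ∈ H) : (gammaRelComm Γ H).Normal := by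
  constructor
  intro n hnn g
  have hnH : n ∈ H := gammaRelComm_le Γ H hinv hnn
  have h1 : g * n * g⁻¹ * n⁻¹ ∈ gammaRelComm Γ H :=
    Subgroup.subset_closure ⟨g, 1, n, hnH, by rw [one_smul]⟩
  have h2 := mul_mem h1 hnn
  simpa [mul_assoc] using h2

theorem gammaRelComm_smul_mem {Γ G : Type*} [Group Γ] [Group G] [MulDistribMulAction Γ G]
    (H : Subgroup G) (hinv : ∀ (σ : Γ), ∀ y ∈ H, σ • y ∈ H) (σ : Γ) {x : G}
    (hx : x ∈ gammaRelComm Γ H) : σ • x ∈ gammaRelComm Γ H := by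
  induction hx using Subgroup.closure_induction with
  | mem z hz =>
    obtain ⟨a, τ, y, hy, rfl⟩ := hz
    refine Subgroup.subset_closure ⟨σ • a, σ * τ * σ⁻¹, σ • y, hinv σ y hy, ?_⟩
    rw [smul_mul', smul_mul', smul_mul', smul_inv', smul_inv', ← mul_smul, ← mul_smul]
    simp [mul_assoc]
  | one => simpa using one_mem (gammaRelComm Γ H)
  | mul a b _ _ iha ihb => rw [smul_mul']; exact mul_mem iha ihb
  | inv a _ iha => rw [smul_inv']; exact inv_mem iha

/-- The Γ-action on a quotient of a Γ-group by a Γ-invariant normal subgroup. -/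
def quotientGammaAction {Γ K : Type*} [Group Γ] [Group K] [MulDistribMulAction Γ K]
    (N : Subgroup K) [N.Normal] (hinv : ∀ (σ : Γ), ∀ y ∈ N, σ • y ∈ N) :
    MulDistribMulAction Γ (K ⧸ N) where
  smul σ := QuotientGroup.map N N (MulDistribMulAction.toMonoidEnd Γ K σ)
    (fun y hy => hinv σ y hy)
  one_smul q := by
    induction q using QuotientGroup.induction_on with
    | _ x =>
      show QuotientGroup.mk ((1 : Γ) • x) = QuotientGroup.mk x
      rw [one_smul]
  mul_smul σ τ q := by
    induction q using QuotientGroup.induction_on with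
    | _ x =>
      show QuotientGroup.mk ((σ * τ) • x) = QuotientGroup.mk (σ • (τ • x))
      rw [mul_smul]
  smul_mul σ a b := by
    induction a using QuotientGroup.induction_on with
    | _ x =>
      induction b using QuotientGroup.induction_on with
      | _ y =>
        show QuotientGroup.mk (σ • (x * y)) = QuotientGroup.mk (σ • x) * QuotientGroup.mk (σ • y)
        rw [← QuotientGroup.mk_mul, smul_mul']
  smul_one σ := by
    show QuotientGroup.mk (σ • (1 : K)) = 1
    rw [smul_one]
    rfl

theorem map_mem_gammaCommutator {Γ P Q : Type*} [Group Γ] [Group P] [Group Q]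
    [MulDistribMulAction Γ P] [MulDistribMulAction Γ Q] (f : P →* Q)
    (hf : ∀ (σ : Γ) (p : P), f (σ • p) = σ • f p) {x : P} (hx : x ∈ gammaCommutator Γ P) :
    f x ∈ gammaCommutator Γ Q := by
  suffices h : gammaCommutator Γ P ≤ (gammaCommutator Γ Q).comap f from h hx
  rw [gammaCommutator, Subgroup.closure_le]
  rintro _ (⟨a, b, rfl⟩ | ⟨σ, g, rfl⟩)
  · exact Subgroup.subset_closure (Or.inl ⟨f a, f b, by simp⟩)
  · exact Subgroup.subset_closure (Or.inr ⟨σ, f g, by simp [hf]⟩)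

theorem map_mem_gammaRelComm {Γ P Q : Type*} [Group Γ] [Group P] [Group Q]
    [MulDistribMulAction Γ P] [MulDistribMulAction Γ Q] (f : P →* Q)
    (hf : ∀ (σ : Γ) (p : P), f (σ • p) = σ • f p) {H : Subgroup P} {K : Subgroup Q}
    (hHK : ∀ y ∈ H, f y ∈ K) {x : P} (hx : x ∈ gammaRelComm Γ H) :
    f x ∈ gammaRelComm Γ K := by
  suffices h : gammaRelComm Γ H ≤ (gammaRelComm Γ K).comap f from h hx
  rw [gammaRelComm, Subgroup.closure_le]
  rintro _ ⟨a, σ, y, hy, rfl⟩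
  exact Subgroup.subset_closure ⟨f a, σ, f y, hHK y hy, by simp [hf]⟩

/-- Two Γ-homomorphisms that agree modulo `K` agree modulo `[Q,K]_Γ` on `[P,P]_Γ`. -/
theorem inv_mul_mem_gammaRelComm {Γ P Q : Type*} [Group Γ] [Group P] [Group Q]
    [MulDistribMulAction Γ P] [MulDistribMulAction Γ Q] (f g : P →* Q)
    (hf : ∀ (σ : Γ) (p : P), f (σ • p) = σ • f p)
    (hg : ∀ (σ : Γ) (p : P), g (σ • p) = σ • g p)
    (K : Subgroup Q) [(gammaRelComm Γ K).Normal] (hfg : ∀ p, (f p)⁻¹ * g p ∈ K)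
    {x : P} (hx : x ∈ gammaCommutator Γ P) :
    (f x)⁻¹ * g x ∈ gammaRelComm Γ K := by
  let π := QuotientGroup.mk' (gammaRelComm Γ K)
  have hconj (a : Q) (σ : Γ) (y : Q) (hy : y ∈ K) : π a * π (σ • y) * (π a)⁻¹ = π y := by
    rw [← mul_inv_eq_one]
    simp only [← map_mul, ← map_inv]
    exact (QuotientGroup.eq_one_iff _).2 (Subgroup.subset_closure ⟨a, σ, y, hy, rfl⟩)
  have hsmul (σ : Γ) (y : Q) (hy : y ∈ K) : π (σ • y) = π y := by
    simpa using hconj 1 σ y hy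
  have hcomm (a y : Q) (hy : y ∈ K) : π a * π y = π y * π a := by
    simpa [mul_inv_eq_iff_eq_mul] using hconj a 1 y hy
  have hdecomp (p : P) : ∃ z ∈ K, g p = f p * z := ⟨_, hfg p, by simp⟩
  suffices h : gammaCommutator Γ P ≤ (π.comp f).eqLocus (π.comp g) from
    QuotientGroup.eq.1 (h hx)
  rw [gammaCommutator, Subgroup.closure_le]
  rintro _ (⟨a, b, rfl⟩ | ⟨σ, p, rfl⟩)
  · obtain ⟨y, hy, hay⟩ := hdecomp a
    obtain ⟨z, hz, hbz⟩ := hdecomp b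
    show π (f _) = π (g _)
    have hcz : π (f (a * b * a⁻¹)) * π z = π z * π (f (a * b * a⁻¹)) := hcomm _ z hz
    simp only [map_mul, map_inv] at hcz
    calc π (f (a * b * a⁻¹ * b⁻¹))
        = π z * (π (f a) * π (f b) * (π (f a))⁻¹) * (π z)⁻¹ * (π (f b))⁻¹ := by
          rw [← hcz]; simp
      _ = π (f a) * (π (f b) * π z) * (π (f a))⁻¹ * (π z)⁻¹ * (π (f b))⁻¹ := by
          rw [hcomm (f b) z hz, ← mul_assoc (π (f a)), hcomm (f a) z hz]
          simp only [mul_assoc]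
      _ = π (f a) * (π y * (π (f b * z))) * (π y)⁻¹ * (π (f a))⁻¹ *
            (π z)⁻¹ * (π (f b))⁻¹ := by
          rw [← hcomm (f b * z) y hy]; simp [mul_assoc]
      _ = π (g (a * b * a⁻¹ * b⁻¹)) := by simp [hay, hbz, mul_assoc]
  · obtain ⟨z, hz, hpz⟩ := hdecomp p
    show π (f _) = π (g _)
    simp only [map_mul, map_inv, hf, hg, hpz, smul_mul', hsmul σ z hz, mul_inv_rev]
    group

/-- The homomorphism induced on Hopf quotients by a Γ-homomorphism carrying `H` into `K`. -/
def hopfQuotientMap {Γ P Q : Type*} [Group Γ] [Group P] [Group Q]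
    [MulDistribMulAction Γ P] [MulDistribMulAction Γ Q] (f : P →* Q)
    (hf : ∀ (σ : Γ) (p : P), f (σ • p) = σ • f p) (H : Subgroup P) (K : Subgroup Q)
    [(gammaRelComm Γ H).Normal] [(gammaRelComm Γ K).Normal] (hHK : ∀ y ∈ H, f y ∈ K) :
    (↥(H ⊓ gammaCommutator Γ P) ⧸
        (gammaRelComm Γ H).subgroupOf (H ⊓ gammaCommutator Γ P)) →*
      (↥(K ⊓ gammaCommutator Γ Q) ⧸
        (gammaRelComm Γ K).subgroupOf (K ⊓ gammaCommutator Γ Q)) :=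
  QuotientGroup.map _ _
    ((f.comp (H ⊓ gammaCommutator Γ P).subtype).codRestrict (K ⊓ gammaCommutator Γ Q)
      fun x => ⟨hHK _ x.2.1, map_mem_gammaCommutator f hf x.2.2⟩)
    fun _ hx => map_mem_gammaRelComm f hf hHK hx

theorem hopfQuotientMap_leftInverse {Γ P Q : Type*} [Group Γ] [Group P] [Group Q]
    [MulDistribMulAction Γ P] [MulDistribMulAction Γ Q] (f : P →* Q) (g : Q →* P)
    (hf : ∀ (σ : Γ) (p : P), f (σ • p) = σ • f p)
    (hg : ∀ (σ : Γ) (q : Q), g (σ • q) = σ • g q) (H : Subgroup P) (K : Subgroup Q)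
    [(gammaRelComm Γ H).Normal] [(gammaRelComm Γ K).Normal]
    (hHK : ∀ y ∈ H, f y ∈ K) (hKH : ∀ y ∈ K, g y ∈ H)
    (hgf : ∀ p, (g (f p))⁻¹ * p ∈ H) :
    Function.LeftInverse (hopfQuotientMap g hg K H hKH) (hopfQuotientMap f hf H K hHK) := by
  intro q
  induction q using QuotientGroup.induction_on with
  | _ x =>
    refine QuotientGroup.eq.2 ?_
    exact inv_mul_mem_gammaRelComm (g.comp f) (MonoidHom.id P) (fun σ p => by simp [hf, hg])
      (fun _ _ => rfl) H hgf x.2.2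

/-- A retract of a free group on a Γ-set lifts along Γ-homomorphisms with a Γ-equivariant
set-theoretic section. -/
theorem exists_gammaHom_lift {Γ X P Q G : Type*} [Group Γ] [MulAction Γ X] [Group P] [Group Q]
    [Group G] [MulDistribMulAction Γ P] [MulDistribMulAction Γ Q] [MulDistribMulAction Γ G]
    (i : P →* FreeGroup X) (r : FreeGroup X →* P)
    (hi : ∀ (σ : Γ) (p : P), i (σ • p) = σ • i p)
    (hr : ∀ (σ : Γ) (w : FreeGroup X), r (σ • w) = σ • r w)
    (hri : r.comp i = MonoidHom.id P)
    (τ : P →* G) (hτ : ∀ (σ : Γ) (p : P), τ (σ • p) = σ • τ p)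
    (ρ : Q →* G) (s : G → Q) (hs : ∀ (σ : Γ) (g : G), s (σ • g) = σ • s g)
    (hρs : ∀ g, ρ (s g) = g) :
    ∃ f : P →* Q, (∀ (σ : Γ) (p : P), f (σ • p) = σ • f p) ∧ ∀ p, ρ (f p) = τ p := by
  let φ : FreeGroup X →* Q := FreeGroup.lift fun x => s (τ (r (FreeGroup.of x)))
  have hsmul_of (σ : Γ) (x : X) : FreeGroup.of (σ • x) = σ • FreeGroup.of x :=
    (FreeGroup.map.of (f := (σ • · : X → X))).symm
  have hφ (σ : Γ) : φ.comp (MulDistribMulAction.toMonoidHom (FreeGroup X) σ) =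
      (MulDistribMulAction.toMonoidHom Q σ).comp φ := by
    ext x
    show φ (σ • FreeGroup.of x) = σ • φ (FreeGroup.of x)
    simp only [φ, ← hsmul_of, FreeGroup.lift_apply_of]
    rw [hsmul_of, hr, hτ, hs]
  have hρφ : ρ.comp φ = τ.comp r := by
    ext x
    simp [φ, hρs]
  refine ⟨φ.comp i, fun σ p => ?_, fun p => ?_⟩
  · simpa [hi] using DFunLike.congr_fun (hφ σ) (i p)
  · have h₁ : ρ (φ (i p)) = τ (r (i p)) := DFunLike.congr_fun hρφ (i p)
    have h₂ : r (i p) = p := DFunLike.congr_fun hri p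
    simp [h₁, h₂]

/-- Let `τ : P →* G` and `τ₁ : P₁ →* G` be two projective presentations of
a Γ-group `G`, with kernels `R` and `R₁`.  Then there is an isomorphism (of abelian groups)
`(R ⊓ [P,P]_Γ)/[P,R]_Γ ≅ (R₁ ⊓ [P₁,P₁]_Γ)/[P₁,R₁]_Γ`: this group does not depend on the
chosen projective presentation. -/
theorem hopfQuotient_independent_of_presentation {Γ : Type u} [Group Γ]
    {P P₁ G : Type v} [Group P] [Group P₁] [Group G]
    [MulDistribMulAction Γ P] [MulDistribMulAction Γ P₁] [MulDistribMulAction Γ G]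
    (X : Type v) [MulAction Γ X] (i : P →* FreeGroup X) (r : FreeGroup X →* P)
    (hi : ∀ (σ : Γ) (p : P), i (σ • p) = σ • i p)
    (hr : ∀ (σ : Γ) (w : FreeGroup X), r (σ • w) = σ • r w)
    (hri : r.comp i = MonoidHom.id P)
    (τ : P →* G) (hτs : Function.Surjective τ)
    (hτe : ∀ (σ : Γ) (p : P), τ (σ • p) = σ • τ p)
    (hsec : ∃ s : G → P, (∀ (σ : Γ) (g : G), s (σ • g) = σ • s g) ∧ ∀ g, τ (s g) = g)
    (X₁ : Type v) [MulAction Γ X₁] (i₁ : P₁ →* FreeGroup X₁) (r₁ : FreeGroup X₁ →* P₁)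
    (hi₁ : ∀ (σ : Γ) (p : P₁), i₁ (σ • p) = σ • i₁ p)
    (hr₁ : ∀ (σ : Γ) (w : FreeGroup X₁), r₁ (σ • w) = σ • r₁ w)
    (hri₁ : r₁.comp i₁ = MonoidHom.id P₁)
    (τ₁ : P₁ →* G) (hτ₁s : Function.Surjective τ₁)
    (hτ₁e : ∀ (σ : Γ) (p : P₁), τ₁ (σ • p) = σ • τ₁ p)
    (hsec₁ : ∃ s : G → P₁, (∀ (σ : Γ) (g : G), s (σ • g) = σ • s g) ∧ ∀ g, τ₁ (s g) = g) :
    have hkerinv : ∀ (σ : Γ), ∀ y ∈ τ.ker, σ • y ∈ τ.ker := fun σ y hy => by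
      rw [MonoidHom.mem_ker] at hy ⊢
      rw [hτe, hy, smul_one]
    have hkerinv₁ : ∀ (σ : Γ), ∀ y ∈ τ₁.ker, σ • y ∈ τ₁.ker := fun σ y hy => by
      rw [MonoidHom.mem_ker] at hy ⊢
      rw [hτ₁e, hy, smul_one]
    haveI hN : (gammaRelComm Γ τ.ker).Normal := gammaRelComm_normal Γ τ.ker hkerinv
    haveI hN₁ : (gammaRelComm Γ τ₁.ker).Normal := gammaRelComm_normal Γ τ₁.ker hkerinv₁
    Nonempty
      ((↥(τ.ker ⊓ gammaCommutator Γ P) ⧸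
          ((gammaRelComm Γ τ.ker).subgroupOf (τ.ker ⊓ gammaCommutator Γ P))) ≃*
        (↥(τ₁.ker ⊓ gammaCommutator Γ P₁) ⧸
          ((gammaRelComm Γ τ₁.ker).subgroupOf (τ₁.ker ⊓ gammaCommutator Γ P₁)))) := by
  intro hkerinv hkerinv₁
  have hN := gammaRelComm_normal Γ τ.ker hkerinv
  have hN₁ := gammaRelComm_normal Γ τ₁.ker hkerinv₁
  obtain ⟨s, hs, hτs⟩ := hsec
  obtain ⟨s₁, hs₁, hτs₁⟩ := hsec₁
  obtain ⟨f, hf, hτf⟩ := exists_gammaHom_lift i r hi hr hri τ hτe τ₁ s₁ hs₁ hτs₁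
  obtain ⟨g, hg, hτg⟩ := exists_gammaHom_lift i₁ r₁ hi₁ hr₁ hri₁ τ₁ hτ₁e τ s hs hτs
  have hfker : ∀ y ∈ τ.ker, f y ∈ τ₁.ker := fun y hy => (hτf y).trans hy
  have hgker : ∀ y ∈ τ₁.ker, g y ∈ τ.ker := fun y hy => (hτg y).trans hy
  have hgf : ∀ p, (g (f p))⁻¹ * p ∈ τ.ker := fun p => by simp [MonoidHom.mem_ker, hτf, hτg]
  have hfg : ∀ p, (f (g p))⁻¹ * p ∈ τ₁.ker := fun p => by simp [MonoidHom.mem_ker, hτf, hτg]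
  exact ⟨{ hopfQuotientMap f hf τ.ker τ₁.ker hfker with
    invFun := hopfQuotientMap g hg τ₁.ker τ.ker hgker
    left_inv := hopfQuotientMap_leftInverse f g hf hg _ _ hfker hgker hgf
    right_inv := hopfQuotientMap_leftInverse g f hg hf _ _ hgker hfker hfg }⟩
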